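/- For every real number Λ ≥ 0, 12 Σ_{n=1}^∞ (e^{−Λ} Λⁿ / n!) · Σ_{k=1}^{n} C(n+1, k) (1/6)^k (1/6)^{n+1−k} = 4 (e^{−2Λ/3} − e^{−5Λ/6}), where C(n+1,k) denotes the binomial coefficient. -/

import Mathlib

/-- The binomial theorem at `(x, x)` with the two extreme terms removed. -/
theorem sum_Icc_choose_mul_pow (x : ℝ) (m : ℕ) :
    ∑ k ∈ Finset.Icc 1 (m + 1), (Nat.choose (m + 2) k : ℝ) * x ^ k * x ^ (m + 2 - k)
      = (2 * x) ^ (m + 2) - 2 * x ^ (m + 2) := by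
  have h := add_pow x x (m + 2)
  rw [Finset.sum_range_succ, Finset.sum_range_succ'] at h
  have hshift : ∑ k ∈ Finset.Icc 1 (m + 1),
      (Nat.choose (m + 2) k : ℝ) * x ^ k * x ^ (m + 2 - k)
      = ∑ k ∈ Finset.range (m + 1),
        x ^ (k + 1) * x ^ (m + 2 - (k + 1)) * (Nat.choose (m + 2) (k + 1) : ℝ) := by
    rw [← Finset.Ico_add_one_right_eq_Icc, Finset.sum_Ico_eq_sum_range]
    refine Finset.sum_congr (by simp) fun k _ => ?_
    rw [add_comm 1 k]
    ring
  rw [hshift, two_mul x, h]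
  simp
  ring

theorem hasSum_pow_div_factorial (x : ℝ) :
    HasSum (fun n : ℕ => x ^ n / (Nat.factorial n : ℝ)) (Real.exp x) := by
  rw [Real.exp_eq_exp_ℝ]
  exact NormedSpace.expSeries_div_hasSum_exp x

theorem OUM_edge_probability (L : ℝ) (hL : 0 ≤ L) :
    12 * ∑' m : ℕ, (Real.exp (-L) * L ^ (m + 1) / (Nat.factorial (m + 1) : ℝ))
        * ∑ k ∈ Finset.Icc 1 (m + 1),
            (Nat.choose (m + 2) k : ℝ) * (1 / 6 : ℝ) ^ k * (1 / 6 : ℝ) ^ (m + 2 - k)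
    = 4 * (Real.exp (-2 * L / 3) - Real.exp (-5 * L / 6)) := by
  have hexp : HasSum
      (fun n : ℕ => Real.exp (-L) / 3 *
        ((L / 3) ^ n / (Nat.factorial n : ℝ) - (L / 6) ^ n / (Nat.factorial n : ℝ)))
      (Real.exp (-L) / 3 * (Real.exp (L / 3) - Real.exp (L / 6))) :=
    ((hasSum_pow_div_factorial (L / 3)).sub (hasSum_pow_div_factorial (L / 6))).mul_left _
  have htail := (hasSum_nat_add_iff' 1).mpr hexp
  have hterm : ∀ m : ℕ, (Real.exp (-L) * L ^ (m + 1) / (Nat.factorial (m + 1) : ℝ))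
      * ∑ k ∈ Finset.Icc 1 (m + 1),
          (Nat.choose (m + 2) k : ℝ) * (1 / 6 : ℝ) ^ k * (1 / 6 : ℝ) ^ (m + 2 - k)
      = Real.exp (-L) / 3 * ((L / 3) ^ (m + 1) / (Nat.factorial (m + 1) : ℝ)
        - (L / 6) ^ (m + 1) / (Nat.factorial (m + 1) : ℝ)) := by
    intro m
    rw [sum_Icc_choose_mul_pow, show (2 * (1 / 6) : ℝ) = 1 / 3 by norm_num,
      div_eq_mul_one_div L 3, div_eq_mul_one_div L 6, mul_pow, mul_pow]
    ring
  rw [tsum_congr hterm, htail.tsum_eq,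
    show -2 * L / 3 = -L + L / 3 by ring, show -5 * L / 6 = -L + L / 6 by ring,
    Real.exp_add, Real.exp_add]
  simp
  ring
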